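/- arXiv:math/9510210 — 5 statements merged into one kernel-verified Lean document; each statement's English description precedes it below -/
import Mathlib

section
/- Let T be the free (tensor) algebra over 𝔽₂ on two generators u, v, and let ψ : T → T ⊗ T be the unique 𝔽₂-algebra homomorphism with ψ(u) = u⊗1 + 1⊗u and ψ(v) = v⊗1 + 1⊗v + u⊗u. Then for w = v² + u[u,v] one has ψ(w) = w⊗1 + 1⊗w + u²⊗u². -/
/-- `T` is the free (tensor) algebra over `𝔽₂ = ZMod 2` on two generators. -/
abbrev T := FreeAlgebra (ZMod 2) (Fin 2)

/-- The generator `u` of `T`. -/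
noncomputable def u : T := FreeAlgebra.ι (ZMod 2) 0

/-- The generator `v` of `T`. -/
noncomputable def v : T := FreeAlgebra.ι (ZMod 2) 1

/-- The commutator `[x,y] = xy + yx` (characteristic 2). -/
noncomputable def br (x y : T) : T := x * y + y * x

open TensorProduct in
/-- If `ψ : T → T ⊗ T` is the 𝔽₂-algebra homomorphism with `ψ(u) = u⊗1 + 1⊗u` and
`ψ(v) = v⊗1 + 1⊗v + u⊗u`, then for `w = v² + u[u,v]` one has
`ψ(w) = w⊗1 + 1⊗w + u²⊗u²`. -/
theorem psi_vsq_plus_u_comm (ψ : T →ₐ[ZMod 2] T ⊗[ZMod 2] T)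
    (hψu : ψ u = u ⊗ₜ[ZMod 2] 1 + 1 ⊗ₜ[ZMod 2] u)
    (hψv : ψ v = v ⊗ₜ[ZMod 2] 1 + 1 ⊗ₜ[ZMod 2] v + u ⊗ₜ[ZMod 2] u)
    (w : T) (hw : w = v ^ 2 + u * br u v) :
    ψ w = w ⊗ₜ[ZMod 2] 1 + 1 ⊗ₜ[ZMod 2] w + (u ^ 2) ⊗ₜ[ZMod 2] (u ^ 2) := by
  have add_self (x : T ⊗[ZMod 2] T) : x + x = 0 := by
    rw [← two_smul (ZMod 2) x, show (2 : ZMod 2) = 0 from rfl, zero_smul]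
  have two_zsmul_eq_zero (x : T ⊗[ZMod 2] T) : (2 : ℤ) • x = 0 := by
    rw [two_zsmul, add_self]
  have four_zsmul_eq_zero (x : T ⊗[ZMod 2] T) : (4 : ℤ) • x = 0 := by
    rw [show (4 : ℤ) = 2 * 2 from rfl, mul_smul, two_zsmul_eq_zero]
  have five_zsmul_eq_self (x : T ⊗[ZMod 2] T) : (5 : ℤ) • x = x := by
    rw [show (5 : ℤ) = 4 + 1 from rfl, add_smul, four_zsmul_eq_zero, zero_add, one_smul]
  subst hw
  simp only [br, pow_two, map_add, map_mul, hψu, hψv, mul_add, add_mul,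
    Algebra.TensorProduct.tmul_mul_tmul, TensorProduct.add_tmul, TensorProduct.tmul_add,
    mul_one, one_mul]
  abel_nf
  simp only [two_zsmul_eq_zero, four_zsmul_eq_zero, five_zsmul_eq_self, zero_add]
end

section
/- Let T be the free (tensor) algebra over 𝔽₂ on two generators u, v, and let ψ : T → T ⊗ T be the unique 𝔽₂-algebra homomorphism with ψ(u) = u⊗1 + 1⊗u and ψ(v) = v⊗1 + 1⊗v + u⊗u. Then the commutator [u²,v] = u²v + vu² is primitive, i.e. ψ([u²,v]) = [u²,v]⊗1 + 1⊗[u²,v]. -/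
open TensorProduct in
/-- If `ψ : T → T ⊗ T` is the 𝔽₂-algebra homomorphism with `ψ(u) = u⊗1 + 1⊗u` and
`ψ(v) = v⊗1 + 1⊗v + u⊗u`, then `[u²,v] = u²v + vu²` is primitive:
`ψ([u²,v]) = [u²,v]⊗1 + 1⊗[u²,v]`. -/
theorem comm_usq_v_primitive (ψ : T →ₐ[ZMod 2] T ⊗[ZMod 2] T)
    (hψu : ψ u = u ⊗ₜ[ZMod 2] 1 + 1 ⊗ₜ[ZMod 2] u)
    (hψv : ψ v = v ⊗ₜ[ZMod 2] 1 + 1 ⊗ₜ[ZMod 2] v + u ⊗ₜ[ZMod 2] u) :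
    ψ (br (u ^ 2) v) = (br (u ^ 2) v) ⊗ₜ[ZMod 2] 1 + 1 ⊗ₜ[ZMod 2] (br (u ^ 2) v) := by
  have hψu2 : ψ (u ^ 2) = (u ^ 2) ⊗ₜ[ZMod 2] 1 + 1 ⊗ₜ[ZMod 2] (u ^ 2) := by
    rw [map_pow, hψu, pow_two]
    simp only [add_mul, mul_add, Algebra.TensorProduct.tmul_mul_tmul, one_mul, mul_one, pow_two]
    have h := ZModModule.add_self (u ⊗ₜ[ZMod 2] u)
    linear_combination (norm := abel) h
  have huu : u ^ 2 * u = u * u ^ 2 := ((Commute.refl u).pow_left 2).eq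
  rw [br, map_add, map_mul, map_mul, hψu2, hψv]
  simp only [add_mul, mul_add, Algebra.TensorProduct.tmul_mul_tmul, one_mul, mul_one,
    TensorProduct.add_tmul, TensorProduct.tmul_add, huu]
  have h₁ := ZModModule.add_self ((u ^ 2) ⊗ₜ[ZMod 2] v)
  have h₂ := ZModModule.add_self (v ⊗ₜ[ZMod 2] (u ^ 2))
  have h₃ := ZModModule.add_self ((u * u ^ 2) ⊗ₜ[ZMod 2] u)
  have h₄ := ZModModule.add_self (u ⊗ₜ[ZMod 2] (u * u ^ 2))
  linear_combination (norm := abel) h₁ + h₂ + h₃ + h₄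
end

section
/- Let T be the free (tensor) algebra over 𝔽₂ on two generators u, v, and let ψ : T → T ⊗ T be the unique 𝔽₂-algebra homomorphism with ψ(u) = u⊗1 + 1⊗u and ψ(v) = v⊗1 + 1⊗v + u⊗u. Then the element w = [u,v²] + u[u²,v] is primitive, i.e. ψ(w) = w⊗1 + 1⊗w. -/
open TensorProduct in
/-- If `ψ : T → T ⊗ T` is the 𝔽₂-algebra homomorphism with `ψ(u) = u⊗1 + 1⊗u` and
`ψ(v) = v⊗1 + 1⊗v + u⊗u`, then `w = [u,v²] + u[u²,v]` is primitive:
`ψ(w) = w⊗1 + 1⊗w`. -/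
theorem comm_u_vsq_plus_primitive (ψ : T →ₐ[ZMod 2] T ⊗[ZMod 2] T)
    (hψu : ψ u = u ⊗ₜ[ZMod 2] 1 + 1 ⊗ₜ[ZMod 2] u)
    (hψv : ψ v = v ⊗ₜ[ZMod 2] 1 + 1 ⊗ₜ[ZMod 2] v + u ⊗ₜ[ZMod 2] u)
    (w : T) (hw : w = br u (v ^ 2) + u * br (u ^ 2) v) :
    ψ w = w ⊗ₜ[ZMod 2] 1 + 1 ⊗ₜ[ZMod 2] w := by
  have even_zsmul {n : ℤ} (hn : (n : ZMod 2) = 0) (x : T ⊗[ZMod 2] T) : n • x = 0 := by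
    rw [← Int.cast_smul_eq_zsmul (ZMod 2) n x, hn, zero_smul]
  subst hw
  simp only [br, map_add, map_mul, hψu, hψv, pow_two, mul_add, add_mul,
    Algebra.TensorProduct.tmul_mul_tmul, one_mul, mul_one, mul_assoc,
    TensorProduct.add_tmul, TensorProduct.tmul_add]
  rw [← sub_eq_zero]
  abel_nf
  simp only [even_zsmul (n := 2) rfl, even_zsmul (n := 4) rfl, even_zsmul (n := 6) rfl,
    even_zsmul (n := 8) rfl, add_zero]
end

section
/- Let T be the free (tensor) algebra over 𝔽₂ on two generators u, v, and let F be the free (tensor) algebra over 𝔽₂ on five generators z₁,…,z₅. Then the unique 𝔽₂-algebra homomorphism φ : F → T determined by φ(z₁) = u², φ(z₂) = [u,v], φ(z₃) = v² + u[u,v], φ(z₄) = [u²,v], φ(z₅) = [u,v²] + u[u²,v] is injective; in other words, the subalgebra of T generated by these five elements is a free associative algebra on them. -/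
/-- `F` is the free (tensor) algebra over `𝔽₂ = ZMod 2` on five generators. -/
abbrev F := FreeAlgebra (ZMod 2) (Fin 5)

theorem add_self_eq_zero_of_zmod_two (x : F) : x + x = 0 := by
  rw [← two_smul (ZMod 2) x, show (2 : ZMod 2) = 0 from rfl, zero_smul]

/-- The matrix over `F` of right multiplication by `u` on `T`, regarded as a free left `F`-module
with basis `1, u, v, uv`. -/
noncomputable def mulRightU : Matrix (Fin 4) (Fin 4) F :=
  let z := FreeAlgebra.ι (ZMod 2) (X := Fin 5)
  !![0, 1, 0, 0; z 0, 0, 0, 0; z 1, 0, 0, 1; z 3, z 1, z 0, 0]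

/-- The matrix over `F` of right multiplication by `v` on `T`, regarded as a free left `F`-module
with basis `1, u, v, uv`. -/
noncomputable def mulRightV : Matrix (Fin 4) (Fin 4) F :=
  let z := FreeAlgebra.ι (ZMod 2) (X := Fin 5)
  !![0, 0, 1, 0; 0, 0, 0, 1; z 2 + z 3, z 1, 0, 0; z 4 + z 0 * z 1, z 2, 0, 0]

/-- The representation of `T` by right multiplication on the free left `F`-module with basis
`1, u, v, uv`. -/
noncomputable def mulRightRep : T →ₐ[ZMod 2] Matrix (Fin 4) (Fin 4) F :=
  FreeAlgebra.lift (ZMod 2) ![mulRightU, mulRightV]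

theorem mulRightRep_u : mulRightRep u = mulRightU := by
  simp [mulRightRep, u]

theorem mulRightRep_v : mulRightRep v = mulRightV := by
  simp [mulRightRep, v]

/-- If the first row of `ρ (ι i)` is `(ι i, 0, …, 0)` for every generator, then the first row of
`ρ a` is `(a, 0, …, 0)` for every `a`. -/
theorem row_zero_of_generators (ρ : F →ₐ[ZMod 2] Matrix (Fin 4) (Fin 4) F)
    (h : ∀ i, ρ (FreeAlgebra.ι (ZMod 2) i) 0 = Pi.single 0 (FreeAlgebra.ι (ZMod 2) i)) (a : F) :
    ρ a 0 = Pi.single 0 a := by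
  induction a using FreeAlgebra.induction with
  | grade0 r =>
    rw [AlgHom.commutes]
    ext j
    fin_cases j <;> simp [Matrix.algebraMap_matrix_apply]
  | grade1 i => exact h i
  | mul a b ha hb =>
    rw [map_mul, Matrix.mul_apply_eq_vecMul, ha, Matrix.single_vecMul]
    ext j
    rw [Pi.smul_apply, Matrix.row, hb]
    fin_cases j <;> simp
  | add a b ha hb =>
    rw [map_add, Pi.single_add, ← ha, ← hb]
    rfl

/-- The 𝔽₂-algebra homomorphism `φ : F → T` sending the five generators to
`u²`, `[u,v]`, `v² + u[u,v]`, `[u²,v]`, `[u,v²] + u[u²,v]` is injective; i.e. the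
subalgebra of `T` generated by these five elements is free on them. -/
theorem subalgebra_free (φ : F →ₐ[ZMod 2] T)
    (h1 : φ (FreeAlgebra.ι (ZMod 2) 0) = u ^ 2)
    (h2 : φ (FreeAlgebra.ι (ZMod 2) 1) = br u v)
    (h3 : φ (FreeAlgebra.ι (ZMod 2) 2) = v ^ 2 + u * br u v)
    (h4 : φ (FreeAlgebra.ι (ZMod 2) 3) = br (u ^ 2) v)
    (h5 : φ (FreeAlgebra.ι (ZMod 2) 4) = br u (v ^ 2) + u * br (u ^ 2) v) :
    Function.Injective φ := by
  have row := row_zero_of_generators (mulRightRep.comp φ) fun i => by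
    ext j
    fin_cases i <;> fin_cases j <;>
      simp [h1, h2, h3, h4, h5, br, mulRightRep_u, mulRightRep_v, mulRightU, mulRightV, pow_two,
        Matrix.mul_apply, Fin.sum_univ_four, add_self_eq_zero_of_zmod_two] <;>
      abel_nf <;> simp [two_smul, add_self_eq_zero_of_zmod_two]
  intro a b hab
  have := row a
  rw [AlgHom.comp_apply, hab, ← AlgHom.comp_apply, row b] at this
  exact (Pi.single_injective 0 this).symm
end

section
/- Let T be the free (tensor) algebra over 𝔽₂ on two generators u, v, let ψ : T → T ⊗ T be the unique 𝔽₂-algebra homomorphism with ψ(u) = u⊗1 + 1⊗u and ψ(v) = v⊗1 + 1⊗v + u⊗u, let I be the two-sided ideal of T generated by u², v², and uv + vu, and let π : T → T/I be the quotient algebra map. Then each of the five elements w ∈ {u², [u,v], v² + u[u,v], [u²,v], [u,v²] + u[u²,v]} satisfies ((id_T ⊗ π) ∘ ψ)(w) = w ⊗ π(1) in T ⊗ (T/I). -/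
theorem add_self_eq_zero_of_zmod_two_s7 {M : Type*} [AddCommGroup M] [Module (ZMod 2) M] (z : M) :
    z + z = 0 := by
  rw [← two_nsmul, ← Nat.cast_smul_eq_nsmul (ZMod 2), show ((2 : ℕ) : ZMod 2) = 0 from rfl,
    zero_smul]

/-- The five cotensor identities in a ring of characteristic two:
`a, b` play the roles of `u ⊗ 1, v ⊗ 1`, and `x, y` those of `1 ⊗ π u, 1 ⊗ π v`. -/
theorem five_identities_of_commute {A : Type*} [Ring A] (h2 : ∀ z : A, z + z = 0)
    {a b x y : A} (hxa : x * a = a * x) (hxb : x * b = b * x) (hya : y * a = a * y)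
    (hyb : y * b = b * y) (hxx : x * x = 0) (hyy : y * y = 0) (hyx : y * x = x * y)
    {p q : A} (hp : p = a + x) (hq : q = b + y + a * x) :
    p ^ 2 = a ^ 2 ∧ p * q + q * p = a * b + b * a ∧
    q ^ 2 + p * (p * q + q * p) = b ^ 2 + a * (a * b + b * a) ∧
    p ^ 2 * q + q * p ^ 2 = a ^ 2 * b + b * a ^ 2 ∧
    p * q ^ 2 + q ^ 2 * p + p * (p ^ 2 * q + q * p ^ 2) =
      a * b ^ 2 + b ^ 2 * a + a * (a ^ 2 * b + b * a ^ 2) := by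
  have hd (z w : A) : z = w ↔ z + w = 0 := by
    rw [add_eq_zero_iff_eq_neg, ← eq_neg_of_add_eq_zero_left (h2 w)]
  have hxa' (z : A) : x * (a * z) = a * (x * z) := by rw [← mul_assoc, hxa, mul_assoc]
  have hxb' (z : A) : x * (b * z) = b * (x * z) := by rw [← mul_assoc, hxb, mul_assoc]
  have hya' (z : A) : y * (a * z) = a * (y * z) := by rw [← mul_assoc, hya, mul_assoc]
  have hpp : p ^ 2 = a ^ 2 := by
    rw [hd, hp]
    simp only [sq, mul_add, add_mul, hxa, hxx]
    abel_nf
    simp only [two_zsmul, h2]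
  have hpq : p * q + q * p = a * b + b * a := by
    rw [hd, hp, hq]
    simp only [mul_add, add_mul, mul_assoc, hxa, hxb, hya, hxx, hyx, hxa', mul_zero]
    abel_nf
    simp only [two_zsmul, h2]
  have hqq : q ^ 2 = b ^ 2 + (a * b + b * a) * x := by
    rw [hd, hq]
    simp only [sq, mul_add, add_mul, mul_assoc, hxb, hyb, hxx, hyx, hxa', hya', hyy,
      mul_zero]
    abel_nf
    simp only [two_zsmul, h2]
  have hppq : p ^ 2 * q + q * p ^ 2 = a ^ 2 * b + b * a ^ 2 := by
    rw [hpp, hd, hq]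
    simp only [sq, mul_add, add_mul, mul_assoc, hxa, hya, hxa', hya']
    abel_nf
    simp only [two_zsmul, h2]
  refine ⟨hpp, hpq, ?_, hppq, ?_⟩
  · rw [hpq, hqq, hd, hp]
    simp only [sq, mul_add, add_mul, mul_assoc, hxa, hxb, hxa', hxb']
    abel_nf
    simp only [two_zsmul, h2]
  · rw [hppq, hqq, hd, hp]
    simp only [sq, mul_add, add_mul, mul_assoc, hxa, hxb, hxa', hxb', hxx, mul_zero]
    abel_nf
    simp only [two_zsmul, h2]

open TensorProduct in
/-- Let `ψ : T → T ⊗ T` be the 𝔽₂-algebra homomorphism with `ψ(u) = u⊗1 + 1⊗u` and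
`ψ(v) = v⊗1 + 1⊗v + u⊗u`, and let `π : T → Q = T/I` be the quotient algebra map, where
`I` is the two-sided ideal generated by `u²`, `v²`, `uv + vu` (i.e. `π` is surjective
with kernel `I`).  Then each of the five elements
`w ∈ {u², [u,v], v² + u[u,v], [u²,v], [u,v²] + u[u²,v]}` satisfies
`((id_T ⊗ π) ∘ ψ)(w) = w ⊗ π(1)` in `T ⊗ (T/I)`. -/
theorem cotensor_contains_five_elements (ψ : T →ₐ[ZMod 2] T ⊗[ZMod 2] T)
    (hψu : ψ u = u ⊗ₜ[ZMod 2] 1 + 1 ⊗ₜ[ZMod 2] u)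
    (hψv : ψ v = v ⊗ₜ[ZMod 2] 1 + 1 ⊗ₜ[ZMod 2] v + u ⊗ₜ[ZMod 2] u)
    (Q : Type) [Ring Q] [Algebra (ZMod 2) Q] (π : T →ₐ[ZMod 2] Q)
    (hπsurj : Function.Surjective π)
    (hπker : TwoSidedIdeal.ker (π : T →+* Q) =
      TwoSidedIdeal.span {u ^ 2, v ^ 2, u * v + v * u}) :
    ∀ w ∈ ({u ^ 2, br u v, v ^ 2 + u * br u v, br (u ^ 2) v,
        br u (v ^ 2) + u * br (u ^ 2) v} : Set T),
      (Algebra.TensorProduct.map (AlgHom.id (ZMod 2) T) π) (ψ w) = w ⊗ₜ[ZMod 2] π 1 := by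
  have hker (t : T) (ht : t ∈ ({u ^ 2, v ^ 2, u * v + v * u} : Set T)) : π t = 0 := by
    have h : t ∈ TwoSidedIdeal.ker (π : T →+* Q) := hπker ▸ TwoSidedIdeal.subset_span ht
    simpa [TwoSidedIdeal.mem_ker] using h
  have huu : π u * π u = 0 := by
    rw [← map_mul, ← sq]
    exact hker _ (by simp)
  have hvv : π v * π v = 0 := by
    rw [← map_mul, ← sq]
    exact hker _ (by simp)
  have huv : π v * π u = π u * π v := by
    have h : π u * π v + π v * π u = 0 := by simpa using hker (u * v + v * u) (by simp)
    rw [eq_neg_of_add_eq_zero_right h, ← eq_neg_of_add_eq_zero_left (add_self_eq_zero_of_zmod_two_s7 _)]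
  set Φ := (Algebra.TensorProduct.map (AlgHom.id (ZMod 2) T) π).comp ψ with hΦ
  let L : T →ₐ[ZMod 2] T ⊗[ZMod 2] Q := Algebra.TensorProduct.includeLeft
  obtain ⟨h₁, h₂, h₃, h₄, h₅⟩ := five_identities_of_commute add_self_eq_zero_of_zmod_two_s7
    (a := L u) (b := L v) (x := 1 ⊗ₜ[ZMod 2] π u) (y := 1 ⊗ₜ[ZMod 2] π v)
    (by simp [L]) (by simp [L]) (by simp [L]) (by simp [L])
    (by simp [huu]) (by simp [hvv]) (by simp [huv])
    (p := Φ u) (q := Φ v) (by simp [hΦ, hψu, L]) (by simp [hΦ, hψv, L])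
  have key (w : T) (h : Φ w = L w) :
      (Algebra.TensorProduct.map (AlgHom.id (ZMod 2) T) π) (ψ w) = w ⊗ₜ[ZMod 2] π 1 := by
    rw [map_one]
    exact h
  rintro w (rfl | rfl | rfl | rfl | rfl) <;> apply key <;>
    simpa only [br, map_add, map_mul, map_pow]
end
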